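/- arXiv:0707.3233 — 2 statements merged into one kernel-verified Lean document; each statement's English description precedes it below -/
import Mathlib

section
/- Let p : ℝ → ℝ be a polynomial function and let n ≥ 1 be an integer. Then the regularization p_n has bounded derivative: there exists a constant C ≥ 0 such that |p_n'(η)| ≤ C for all η ∈ ℝ; consequently p_n is Lipschitz continuous with constant C. -/
/-- The regularization `p_n(η) = n·p(η)/√(n² + p(η)²)` of a function `p : ℝ → ℝ`. -/
noncomputable def pReg (p : ℝ → ℝ) (n : ℕ) (η : ℝ) : ℝ :=
  n * p η / Real.sqrt ((n : ℝ) ^ 2 + p η ^ 2)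

/-- If `R` has no real root and `Q` has degree at most that of `R`, then `Q / R` is bounded. -/
theorem Polynomial.exists_abs_eval_le_mul_abs_eval {Q R : Polynomial ℝ}
    (hdeg : Q.degree ≤ R.degree) (hR : ∀ x, R.eval x ≠ 0) :
    ∃ C : ℝ, 0 ≤ C ∧ ∀ x, |Q.eval x| ≤ C * |R.eval x| := by
  have key : ∀ Q R : Polynomial ℝ, Q.degree ≤ R.degree →
      ∃ c a : ℝ, ∀ x ≥ a, |Q.eval x| ≤ c * |R.eval x| := fun Q R h => by
    obtain ⟨c, hc⟩ := (Polynomial.isBigO_atTop_of_degree_le Q R h).bound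
    obtain ⟨a, ha⟩ := Filter.eventually_atTop.1 hc
    exact ⟨c, a, ha⟩
  obtain ⟨c, a, ha⟩ := key Q R hdeg
  obtain ⟨d, b, hb⟩ := key (Q.comp (-Polynomial.X)) (R.comp (-Polynomial.X)) (by
    by_cases hQ : Q = 0
    · simp [hQ]
    have hR0 : R ≠ 0 := fun h => hR 0 (by simp [h])
    have hRc : R.comp (-Polynomial.X) ≠ 0 := fun h => hR 0 (by
      simpa using congrArg (Polynomial.eval 0) h)
    refine Polynomial.degree_le_natDegree.trans ?_
    rw [Polynomial.degree_eq_natDegree hRc, Polynomial.natDegree_comp, Polynomial.natDegree_comp]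
    simpa using Polynomial.natDegree_le_natDegree hdeg)
  have hcont : Continuous fun x => Q.eval x / R.eval x :=
    Q.continuous.div R.continuous hR
  obtain ⟨e, he⟩ := (isCompact_Icc (a := -b) (b := a)).exists_bound_of_continuousOn
    hcont.continuousOn
  refine ⟨max 0 (max c (max d e)), le_max_left _ _, fun x => ?_⟩
  have mono : ∀ t ≤ max 0 (max c (max d e)), |Q.eval x| ≤ t * |R.eval x| →
      |Q.eval x| ≤ max 0 (max c (max d e)) * |R.eval x| := fun t ht h =>
    h.trans (mul_le_mul_of_nonneg_right ht (abs_nonneg _))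
  rcases le_total a x with hx | hx
  · exact mono c (by simp) (ha x hx)
  rcases le_total b (-x) with hx' | hx'
  · exact mono d (by simp) (by simpa using hb (-x) hx')
  · refine mono e (by simp) ?_
    have h := he x ⟨by linarith, hx⟩
    rwa [Real.norm_eq_abs, abs_div, div_le_iff₀ (abs_pos.2 (hR x))] at h

theorem hasDerivAt_pReg {p : ℝ → ℝ} {p' η : ℝ} {n : ℕ} (hn : 1 ≤ n) (hp : HasDerivAt p p' η) :
    HasDerivAt (pReg p n)
      ((n : ℝ) ^ 3 * p' / ((n ^ 2 + p η ^ 2) * Real.sqrt ((n : ℝ) ^ 2 + p η ^ 2))) η := by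
  have hn0 : (0 : ℝ) < n := by exact_mod_cast hn
  have hpos : 0 < (n : ℝ) ^ 2 + p η ^ 2 := by positivity
  have hs : 0 < Real.sqrt ((n : ℝ) ^ 2 + p η ^ 2) := Real.sqrt_pos.2 hpos
  have hsq := Real.sq_sqrt hpos.le
  refine ((hp.const_mul (n : ℝ)).div (((hp.pow 2).const_add ((n : ℝ) ^ 2)).sqrt hpos.ne')
    hs.ne').congr_deriv ?_
  simp only [Pi.pow_apply]
  rw [hsq]
  field_simp
  rw [hsq]
  push_cast
  ring

/-- For a polynomial `p`, the regularization `p_n` has bounded derivative, and is hence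
Lipschitz continuous with the same constant. -/
theorem pReg_lipschitz (P : Polynomial ℝ) (n : ℕ) (hn : 1 ≤ n) :
    ∃ C : ℝ, 0 ≤ C ∧
      (∀ η : ℝ, |deriv (pReg (fun ξ => P.eval ξ) n) η| ≤ C) ∧
      (∀ a b : ℝ, |pReg (fun ξ => P.eval ξ) n a - pReg (fun ξ => P.eval ξ) n b|
        ≤ C * |a - b|) := by
  have hn0 : (0 : ℝ) < n := by exact_mod_cast hn
  have hpos : ∀ x, 0 < (n : ℝ) ^ 2 + P.eval x ^ 2 := fun x => by positivity
  have heval : ∀ x, (P ^ 2 + Polynomial.C ((n : ℝ) ^ 2)).eval x = n ^ 2 + P.eval x ^ 2 :=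
    fun x => by simp [add_comm]
  have hR : ∀ x, (P ^ 2 + Polynomial.C ((n : ℝ) ^ 2)).eval x ≠ 0 := fun x => by
    rw [heval]; exact (hpos x).ne'
  have hdeg : P.derivative.degree ≤ (P ^ 2 + Polynomial.C ((n : ℝ) ^ 2)).degree := by
    have hR0 : P ^ 2 + Polynomial.C ((n : ℝ) ^ 2) ≠ 0 := fun h => hR 0 (by rw [h]; simp)
    refine Polynomial.degree_le_natDegree.trans ?_
    rw [Polynomial.degree_eq_natDegree hR0, Polynomial.natDegree_add_C, Polynomial.natDegree_pow]
    have := P.natDegree_derivative_le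
    exact_mod_cast (by lia : P.derivative.natDegree ≤ 2 * P.natDegree)
  obtain ⟨C, hC, hbound⟩ := Polynomial.exists_abs_eval_le_mul_abs_eval hdeg hR
  have hderiv := fun x => hasDerivAt_pReg hn (P.hasDerivAt x)
  have hle : ∀ x, |deriv (pReg (fun ξ => P.eval ξ) n) x| ≤ n ^ 2 * C := fun x => by
    have hb := hbound x
    rw [heval, abs_of_pos (hpos x)] at hb
    have hsqrt : (n : ℝ) ≤ Real.sqrt ((n : ℝ) ^ 2 + P.eval x ^ 2) :=
      Real.le_sqrt_of_sq_le (by nlinarith [sq_nonneg (P.eval x)])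
    have hden : 0 < ((n : ℝ) ^ 2 + P.eval x ^ 2) * Real.sqrt ((n : ℝ) ^ 2 + P.eval x ^ 2) :=
      mul_pos (hpos x) (hn0.trans_le hsqrt)
    rw [(hderiv x).deriv, abs_div, abs_of_pos hden, div_le_iff₀ hden, abs_mul,
      abs_of_pos (pow_pos hn0 3)]
    calc (n : ℝ) ^ 3 * |P.derivative.eval x|
        ≤ n ^ 3 * (C * (n ^ 2 + P.eval x ^ 2)) := by gcongr
      _ = n ^ 2 * C * ((n ^ 2 + P.eval x ^ 2) * n) := by ring
      _ ≤ _ := by gcongr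
  refine ⟨n ^ 2 * C, by positivity, hle, fun a b => ?_⟩
  exact convex_univ.norm_image_sub_le_of_norm_deriv_le
    (fun x _ => (hderiv x).differentiableAt) (fun x _ => hle x) (Set.mem_univ b) (Set.mem_univ a)
end

section
/- Let H be a real normed space and let φ : H → ℝ be such that the map x ↦ φ(x)/(1 + ‖x‖) is uniformly continuous and bounded. For each integer n ≥ 1 define φ_n(x) = n·φ(x)/(n + ‖x‖²). Then each φ_n is a bounded, uniformly continuous function on H; moreover sup_{x∈H} |φ_n(x)|/(1 + ‖x‖) ≤ sup_{x∈H} |φ(x)|/(1 + ‖x‖) for every n, and φ_n(x)/(1 + ‖x‖) → φ(x)/(1 + ‖x‖) as n → ∞ for every x ∈ H. -/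
open Filter Topology

/-- The product of two bounded uniformly continuous real functions is uniformly continuous. -/
theorem UniformContinuous.mul_of_abs_le {X : Type*} [UniformSpace X] {f g : X → ℝ}
    (hf : UniformContinuous f) (hg : UniformContinuous g) {A B : ℝ}
    (hA : ∀ x, |f x| ≤ A) (hB : ∀ x, |g x| ≤ B) :
    UniformContinuous (fun x => f x * g x) := by
  have hmul := Real.uniformContinuous_mul (Set.range fun x => (f x, g x))
    (r₁ := A + 1) (r₂ := B + 1) (by
      rintro _ ⟨x, rfl⟩
      exact ⟨(hA x).trans_lt (lt_add_one A), (hB x).trans_lt (lt_add_one B)⟩)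
  exact hmul.comp ((hf.prodMk hg).subtype_mk fun x => Set.mem_range_self x)

theorem abs_truncation_weight_le {a t : ℝ} (ha : 1 ≤ a) (ht : 0 ≤ t) :
    |a * (1 + t) / (a + t ^ 2)| ≤ 2 * a := by
  rw [abs_of_nonneg (by positivity), div_le_iff₀ (by positivity), mul_comm 2 a, mul_assoc]
  gcongr
  nlinarith [sq_nonneg (t - 1)]

theorem abs_truncation_weight_sub_le {a s t : ℝ} (ha : 1 ≤ a) (hs : 0 ≤ s) (ht : 0 ≤ t) :
    |a * (1 + s) / (a + s ^ 2) - a * (1 + t) / (a + t ^ 2)| ≤ 5 * a * |s - t| := by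
  have hS : 0 < a + s ^ 2 := by positivity
  have hT : 0 < a + t ^ 2 := by positivity
  have hprod : (1 + s) * (1 + t) ≤ (2 * (a + s ^ 2)) * (2 * (a + t ^ 2)) := by
    gcongr
    · nlinarith [sq_nonneg (s - 1)]
    · nlinarith [sq_nonneg (t - 1)]
  have ha' : a ≤ (a + s ^ 2) * (a + t ^ 2) := by
    nlinarith [mul_nonneg (sub_nonneg.2 ha) (zero_le_one.trans ha),
      mul_nonneg (sq_nonneg s) (sq_nonneg t), mul_nonneg (zero_le_one.trans ha) (sq_nonneg s),
      mul_nonneg (zero_le_one.trans ha) (sq_nonneg t)]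
  have hnum : |a - (s + t) - s * t| ≤ 5 * ((a + s ^ 2) * (a + t ^ 2)) := by
    have hst := mul_nonneg hs ht
    rw [abs_le]
    constructor <;> nlinarith
  have heq : a * (1 + s) / (a + s ^ 2) - a * (1 + t) / (a + t ^ 2) =
      a * (s - t) * (a - (s + t) - s * t) / ((a + s ^ 2) * (a + t ^ 2)) := by
    field_simp
    ring
  rw [heq, abs_div, abs_mul, abs_mul, abs_of_pos (mul_pos hS hT),
    abs_of_pos (zero_lt_one.trans_le ha), div_le_iff₀ (mul_pos hS hT)]
  calc a * |s - t| * |a - (s + t) - s * t|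
      ≤ a * |s - t| * (5 * ((a + s ^ 2) * (a + t ^ 2))) := by gcongr
    _ = 5 * a * |s - t| * ((a + s ^ 2) * (a + t ^ 2)) := by ring

theorem uniformContinuous_truncation_weight {H : Type*} [SeminormedAddCommGroup H] {a : ℝ}
    (ha : 1 ≤ a) : UniformContinuous (fun x : H => a * (1 + ‖x‖) / (a + ‖x‖ ^ 2)) := by
  refine (LipschitzWith.of_dist_le' (K := 5 * a) fun x y => ?_).uniformContinuous
  rw [Real.dist_eq, dist_eq_norm]
  refine (abs_truncation_weight_sub_le ha (norm_nonneg x) (norm_nonneg y)).trans ?_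
  gcongr
  exact abs_norm_sub_norm_le x y

/-- Truncation lemma in `C_{b,1}(H)`: if `x ↦ φ(x)/(1+‖x‖)` is uniformly continuous and
bounded, then the truncations `φ_n(x) = n·φ(x)/(n + ‖x‖²)` are bounded and uniformly
continuous, satisfy `sup_x |φ_n(x)|/(1+‖x‖) ≤ sup_x |φ(x)|/(1+‖x‖)`, and
`φ_n(x)/(1+‖x‖) → φ(x)/(1+‖x‖)` pointwise. -/
theorem truncation_pi_approximation
    (H : Type*) [NormedAddCommGroup H] [NormedSpace ℝ H]
    (φ : H → ℝ)
    (huc : UniformContinuous (fun x : H => φ x / (1 + ‖x‖)))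
    (hbd : ∃ C : ℝ, ∀ x : H, |φ x| / (1 + ‖x‖) ≤ C) :
    let φn : ℕ → H → ℝ := fun n x => n * φ x / (n + ‖x‖ ^ 2)
    (∀ n : ℕ, 1 ≤ n → (∃ C : ℝ, ∀ x : H, |φn n x| ≤ C) ∧ UniformContinuous (φn n)) ∧
    (∀ n : ℕ, 1 ≤ n →
      (⨆ x : H, |φn n x| / (1 + ‖x‖)) ≤ ⨆ x : H, |φ x| / (1 + ‖x‖)) ∧
    (∀ x : H, Tendsto (fun n : ℕ => φn n x / (1 + ‖x‖)) atTop
      (𝓝 (φ x / (1 + ‖x‖)))) := by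
  intro φn
  obtain ⟨C, hC⟩ := hbd
  have hpos (x : H) : 0 < 1 + ‖x‖ := by positivity
  have hC' (x : H) : |φ x / (1 + ‖x‖)| ≤ C := by
    rw [abs_div, abs_of_pos (hpos x)]
    exact hC x
  refine ⟨fun n hn => ?_, fun n hn => ?_, fun x => ?_⟩
  · have ha : (1 : ℝ) ≤ n := by exact_mod_cast hn
    have hfactor : φn n =
        fun x => φ x / (1 + ‖x‖) * (n * (1 + ‖x‖) / (n + ‖x‖ ^ 2)) := by
      funext x
      have := (hpos x).ne'
      simp only [φn]
      field_simp
    have hweight (x : H) := abs_truncation_weight_le ha (norm_nonneg x)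
    rw [hfactor]
    refine ⟨⟨C * (2 * n), fun x => ?_⟩,
      huc.mul_of_abs_le (uniformContinuous_truncation_weight ha) hC' hweight⟩
    rw [abs_mul]
    exact mul_le_mul (hC' x) (hweight x) (abs_nonneg _) ((abs_nonneg _).trans (hC' x))
  · have ha : (1 : ℝ) ≤ n := by exact_mod_cast hn
    refine ciSup_mono ⟨C, Set.forall_mem_range.2 hC⟩ fun x => ?_
    have hden : 0 < (n : ℝ) + ‖x‖ ^ 2 := by positivity
    refine div_le_div_of_nonneg_right ?_ (hpos x).le
    simp only [φn]
    rw [abs_div, abs_mul, abs_of_pos hden, Nat.abs_cast, div_le_iff₀ hden, mul_comm]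
    gcongr
    exact le_add_of_nonneg_right (sq_nonneg _)
  · refine Tendsto.div_const ?_ _
    have h := (tendsto_natCast_div_add_atTop (‖x‖ ^ 2)).mul_const (φ x)
    rw [one_mul] at h
    exact h.congr fun n => by simp only [φn]; ring
end
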